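/- (Consistency of the scheme.) Assume (A1) and that M_ξ := sup_{k∈K} ∫_ℝ |z| dP_k(z), R⁰, R¹_Δ and R²_Δ (defined in the context) are finite. Then for every T > 0, Δ ∈ (0,1), every ω : [0,T]×ℝ → ℝ that is bounded and smooth with bounded derivatives of all orders, every t ∈ [Δ,T] and x ∈ ℝ: | ∂_tω(t,x) − sup_{k∈K} ∫_ℝ δ_zω(t,x) F_k(dz) − S(Δ, x, ω(t,x), ω(t−Δ,·)) | ≤ (1 + M_ξ)·( ‖∂_t²ω‖_∞ Δ + ‖∂_t∂_xω‖_∞ Δ^{1/α} ) + R⁰·‖∂_x²ω‖_∞·Δ^{(2−α)/α} + R¹_Δ·‖∂_x²ω‖_∞ + R²_Δ·‖∂_xω‖_∞. -/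

import Mathlib

open MeasureTheory Set Filter

/-- The monotone scheme operator
`S(Δ,x,p,v) = (p - sup_k ∫ v(x + Δ^{1/α} z) dP_k(z)) / Δ`. -/
noncomputable def schemeS {K : Type*} (P : K → MeasureTheory.Measure ℝ)
    (α Δ x p : ℝ) (v : ℝ → ℝ) : ℝ :=
  (p - ⨆ k, ∫ z, v (x + Δ ^ (1 / α) * z) ∂(P k)) / Δ

/-- The nonlocal term `∫_ℝ δ_z w(x) F_{k}(dz)` for the α-stable Lévy measure with
densities `k₋|z|^{-α-1}` on `(-∞,0)` and `k₊ z^{-α-1}` on `(0,∞)`, where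
`δ_z w(x) = w(x+z) - w(x) - w'(x)·z`. -/
noncomputable def levyNonlocal (α kmm kpp : ℝ) (w : ℝ → ℝ) (x : ℝ) : ℝ :=
  (∫ z in Set.Iio (0 : ℝ), (w (x + z) - w x - deriv w x * z) * (kmm * |z| ^ (-α - 1)))
    + ∫ z in Set.Ioi (0 : ℝ), (w (x + z) - w x - deriv w x * z) * (kpp * z ^ (-α - 1))

/-- The quantity inside the supremum defining `R⁰`. -/
noncomputable def R0expr (α : ℝ) (b1 b2 : ℝ → ℝ) : ℝ :=
  |b1 (-1)| + |b2 1|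
    + ∫ z in Set.Ioo (0 : ℝ) 1,
        (|α * b1 (-z) + deriv b1 (-z) * z| + |α * b2 z - deriv b2 z * z|) * z ^ (1 - α)

/-- The quantity inside the supremum defining `R¹_Δ` (without the factor 5). -/
noncomputable def R1expr (α Δ : ℝ) (b1 b2 : ℝ → ℝ) : ℝ :=
  ∫ z in Set.Ioo (0 : ℝ) 1,
    (|b1 (-(z / Δ ^ (1 / α)))| + |b2 (z / Δ ^ (1 / α))|) * z ^ (1 - α)

/-- The quantity inside the supremum defining `R²_Δ` (without the factor 4). -/
noncomputable def R2expr (α Δ : ℝ) (b1 b2 : ℝ → ℝ) : ℝ :=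
  |b1 (-(Δ ^ (-(1 / α))))| + |b2 (Δ ^ (-(1 / α)))|
    + ∫ z in Set.Ioi (1 : ℝ),
        (|b1 (-(z / Δ ^ (1 / α)))| + |b2 (z / Δ ^ (1 / α))|) * z ^ (-α)

/-- Layer-cake formula: integration by parts against the tail of a finite measure. -/
lemma setIntegral_Ioi_eq_integral_deriv_mul_tail (μ : Measure ℝ) [IsFiniteMeasure μ]
    (hμ : Integrable (fun z : ℝ => z) μ) {h h' : ℝ → ℝ} (hd : ∀ z, HasDerivAt h (h' z) z)
    (hc : Continuous h') (h0 : h 0 = 0) {C : ℝ} (hC : ∀ u, |h' u| ≤ C) :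
    ∫ z in Ioi (0 : ℝ), h z ∂μ = ∫ u in Ioi (0 : ℝ), h' u * μ.real (Ioi u) := by
  have hsec : ∀ z ∈ Ioi (0 : ℝ), ∀ k : ℝ → ℝ,
      ∫ u in Ioi (0 : ℝ), (Iio z).indicator k u = ∫ u in (0 : ℝ)..z, k u := by
    intro z hz k
    rw [setIntegral_indicator measurableSet_Iio, Ioi_inter_Iio,
      intervalIntegral.integral_of_le (le_of_lt hz), integral_Ioc_eq_integral_Ioo]
  have hmeas : Measurable (fun p : ℝ × ℝ => (Iio p.1).indicator h' p.2) := by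
    have hset : MeasurableSet {p : ℝ × ℝ | p.2 < p.1} :=
      measurableSet_lt measurable_snd measurable_fst
    exact (hc.measurable.comp measurable_snd).indicator hset
  have hprod : Integrable (Function.uncurry fun z u : ℝ => (Iio z).indicator h' u)
      ((μ.restrict (Ioi 0)).prod (volume.restrict (Ioi 0))) := by
    have hm : AEStronglyMeasurable (Function.uncurry fun z u : ℝ => (Iio z).indicator h' u)
        ((μ.restrict (Ioi 0)).prod (volume.restrict (Ioi 0))) := hmeas.aestronglyMeasurable
    refine (integrable_prod_iff hm).2 ⟨?_, ?_⟩
    · refine Eventually.of_forall fun z => ?_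
      change Integrable ((Iio z).indicator h') (volume.restrict (Ioi 0))
      rw [integrable_indicator_iff measurableSet_Iio, IntegrableOn,
        Measure.restrict_restrict measurableSet_Iio]
      exact (hc.integrableOn_Icc (a := 0) (b := z)).mono_set
        fun u hu => ⟨le_of_lt hu.2, le_of_lt hu.1⟩
    · refine Integrable.mono' ((hμ.const_mul C).integrableOn) hm.norm.integral_prod_right' ?_
      refine (ae_restrict_iff' measurableSet_Ioi).2 (Eventually.of_forall fun z hz => ?_)
      have hz' : (0 : ℝ) ≤ z := le_of_lt hz
      have e : ∫ u in Ioi (0 : ℝ),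
          ‖Function.uncurry (fun z u : ℝ => (Iio z).indicator h' u) (z, u)‖
          = ∫ u in (0 : ℝ)..z, |h' u| := by
        rw [← hsec z hz]
        refine integral_congr_ae (Eventually.of_forall fun u => ?_)
        simp only [Function.uncurry, Real.norm_eq_abs]
        by_cases hu : u ∈ Iio z <;> simp [hu, indicator]
      rw [e, Real.norm_eq_abs, abs_of_nonneg
        (intervalIntegral.integral_nonneg hz' fun u _ => abs_nonneg _)]
      calc ∫ u in (0 : ℝ)..z, |h' u| ≤ ∫ _ in (0 : ℝ)..z, C :=
            intervalIntegral.integral_mono_on hz' (hc.abs.intervalIntegrable _ _)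
              intervalIntegrable_const fun u _ => hC u
        _ = C * z := by simp [mul_comm]
  calc ∫ z in Ioi (0 : ℝ), h z ∂μ
      = ∫ z in Ioi (0 : ℝ), (∫ u in Ioi (0 : ℝ), (Iio z).indicator h' u) ∂μ := by
        refine setIntegral_congr_fun measurableSet_Ioi fun z hz => ?_
        rw [hsec z hz, intervalIntegral.integral_eq_sub_of_hasDerivAt (fun u _ => hd u)
          (hc.intervalIntegrable _ _), h0, sub_zero]
    _ = ∫ u in Ioi (0 : ℝ), ∫ z in Ioi (0 : ℝ), (Iio z).indicator h' u ∂μ :=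
        integral_integral_swap hprod
    _ = ∫ u in Ioi (0 : ℝ), h' u * μ.real (Ioi u) := by
        refine setIntegral_congr_fun measurableSet_Ioi fun u hu => ?_
        have e : (fun z : ℝ => (Iio z).indicator h' u) = (Ioi u).indicator fun _ => h' u := by
          ext z
          simp [indicator]
        simp only [e]
        rw [setIntegral_indicator measurableSet_Ioi, Ioi_inter_Ioi,
          sup_of_le_right (le_of_lt hu), setIntegral_const, smul_eq_mul, mul_comm]

lemma exists_abs_le_of_tendsto_atTop {b : ℝ → ℝ} (hb : ContinuousOn b (Ici 0))
    (hlim : Tendsto b atTop (nhds 0)) : ∃ C, ∀ u ≥ 0, |b u| ≤ C := by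
  have h1 : ∀ᶠ u in atTop, |b u| ≤ 1 := by
    have := hlim.abs
    rw [abs_zero] at this
    exact this.eventually_le_const one_pos
  obtain ⟨N, hN⟩ := eventually_atTop.1 h1
  obtain ⟨C, hC⟩ := (isCompact_Icc (a := (0 : ℝ)) (b := N)).exists_bound_of_continuousOn
    (hb.mono Icc_subset_Ici_self)
  refine ⟨max C 1, fun u hu => ?_⟩
  rcases le_total u N with h | h
  · exact (hC u ⟨hu, h⟩).trans (le_max_left _ _)
  · exact (hN u h).trans (le_max_right _ _)

lemma integrableOn_Ioc_mul_rpow {α C : ℝ} (hα2 : α < 2) {f : ℝ → ℝ}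
    (hf : ContinuousOn f (Ioi 0)) (hC : ∀ u > 0, |f u| ≤ C) :
    IntegrableOn (fun u => f u * u ^ (1 - α)) (Ioc 0 1) := by
  have hr : IntegrableOn (fun u : ℝ => u ^ (1 - α)) (Ioc 0 1) := by
    rw [integrableOn_Ioc_iff_integrableOn_Ioo]
    exact (intervalIntegral.integrableOn_Ioo_rpow_iff one_pos).2 (by linarith)
  refine Integrable.bdd_mul (c := C) hr
    ((hf.mono Ioc_subset_Ioi_self).aestronglyMeasurable measurableSet_Ioc) ?_
  exact (ae_restrict_iff' measurableSet_Ioc).2 (Eventually.of_forall fun u hu => hC u hu.1)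

lemma integrableOn_Ioi_one_mul_rpow {α C : ℝ} (hα1 : 1 < α) {f : ℝ → ℝ}
    (hf : ContinuousOn f (Ioi 0)) (hC : ∀ u > 0, |f u| ≤ C) :
    IntegrableOn (fun u => f u * u ^ (-α)) (Ioi 1) := by
  have hsub : Ioi (1 : ℝ) ⊆ Ioi 0 := Ioi_subset_Ioi zero_le_one
  refine Integrable.bdd_mul (c := C) (integrableOn_Ioi_rpow_of_lt (by linarith) one_pos)
    ((hf.mono hsub).aestronglyMeasurable measurableSet_Ioi) ?_
  exact (ae_restrict_iff' measurableSet_Ioi).2 (Eventually.of_forall fun u hu => hC u (hsub hu))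

/-- A function dominated by `|f u| u^{1-α}` near zero and `|f u| u^{-α}` at infinity, with `f`
bounded, is integrable, with the corresponding bound on its integral. -/
lemma integrableOn_Ioi_and_abs_integral_le {α A D C : ℝ} (hα1 : 1 < α) (hα2 : α < 2)
    {f F : ℝ → ℝ} (hF : ContinuousOn F (Ioi 0)) (hf : ContinuousOn f (Ioi 0))
    (hC : ∀ u > 0, |f u| ≤ C)
    (hA : ∀ u > 0, |F u| ≤ A * (|f u| * u ^ (1 - α)))
    (hD : ∀ u > 0, |F u| ≤ D * (|f u| * u ^ (-α))) :
    IntegrableOn F (Ioi 0) ∧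
      |∫ u in Ioi (0 : ℝ), F u| ≤ A * (∫ u in Ioo (0 : ℝ) 1, |f u| * u ^ (1 - α))
        + D * ∫ u in Ioi (1 : ℝ), |f u| * u ^ (-α) := by
  have hC' : ∀ u > 0, |(|f u|)| ≤ C := fun u hu => by rw [abs_abs]; exact hC u hu
  have i1 := (integrableOn_Ioc_mul_rpow hα2 hf.abs hC').const_mul A
  have i2 := (integrableOn_Ioi_one_mul_rpow hα1 hf.abs hC').const_mul D
  have hsub : Ioi (1 : ℝ) ⊆ Ioi 0 := Ioi_subset_Ioi zero_le_one
  have b1 : ∀ᵐ u ∂volume.restrict (Ioc (0 : ℝ) 1), ‖F u‖ ≤ A * (|f u| * u ^ (1 - α)) :=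
    (ae_restrict_iff' measurableSet_Ioc).2 (Eventually.of_forall fun u hu => hA u hu.1)
  have b2 : ∀ᵐ u ∂volume.restrict (Ioi (1 : ℝ)), ‖F u‖ ≤ D * (|f u| * u ^ (-α)) :=
    (ae_restrict_iff' measurableSet_Ioi).2 (Eventually.of_forall fun u hu => hD u (hsub hu))
  have j1 : IntegrableOn F (Ioc 0 1) := Integrable.mono' i1
    ((hF.mono Ioc_subset_Ioi_self).aestronglyMeasurable measurableSet_Ioc) b1
  have j2 : IntegrableOn F (Ioi 1) := Integrable.mono' i2
    ((hF.mono hsub).aestronglyMeasurable measurableSet_Ioi) b2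
  have hU : Ioc (0 : ℝ) 1 ∪ Ioi 1 = Ioi 0 := Ioc_union_Ioi_eq_Ioi zero_le_one
  refine ⟨hU ▸ j1.union j2, ?_⟩
  rw [← hU, setIntegral_union (Ioc_disjoint_Ioi le_rfl) measurableSet_Ioi j1 j2,
    ← integral_Ioc_eq_integral_Ioo, ← integral_const_mul, ← integral_const_mul]
  exact (abs_add_le _ _).trans (add_le_add (norm_integral_le_of_norm_le i1 b1)
    (norm_integral_le_of_norm_le i2 b2))

/-- Integration by parts for the one-sided stable Lévy density. -/
lemma integral_mul_stable_density {α c A D : ℝ} (hα1 : 1 < α) (hα2 : α < 2) {g g' : ℝ → ℝ}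
    (hd : ∀ z, HasDerivAt g (g' z) z) (hc : Continuous g') (h0 : g 0 = 0)
    (hA : ∀ u > 0, |g' u| ≤ A * u) (hD : ∀ u > 0, |g' u| ≤ D) :
    IntegrableOn (fun z => g z * (c * z ^ (-α - 1))) (Ioi 0) ∧
    IntegrableOn (fun u => g' u * (c / α) * u ^ (-α)) (Ioi 0) ∧
    ∫ z in Ioi (0 : ℝ), g z * (c * z ^ (-α - 1))
      = ∫ u in Ioi (0 : ℝ), g' u * (c / α) * u ^ (-α) := by
  have hα0 : α ≠ 0 := by linarith
  have hgc : Continuous g := continuous_iff_continuousAt.2 fun z => (hd z).continuousAt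
  have hA0 : 0 ≤ A := by
    have := (abs_nonneg _).trans (hA 1 one_pos)
    linarith
  have hD0 : 0 ≤ D := (abs_nonneg _).trans (hD 1 one_pos)
  have hgD : ∀ u > 0, |g u| ≤ D * u := by
    intro u hu
    have := intervalIntegral.integral_eq_sub_of_hasDerivAt (a := 0) (b := u) (fun u _ => hd u)
      (hc.intervalIntegrable _ _)
    rw [h0, sub_zero] at this
    rw [← this]
    have h2 := intervalIntegral.norm_integral_le_of_norm_le_const (a := 0) (b := u) (f := g')
      (C := D) fun v hv => by
        rw [uIoc_of_le hu.le] at hv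
        exact hD v hv.1
    rwa [sub_zero, abs_of_pos hu] at h2
  have hgA : ∀ u > 0, |g u| ≤ A * u * u := by
    intro u hu
    have := intervalIntegral.integral_eq_sub_of_hasDerivAt (a := 0) (b := u) (fun u _ => hd u)
      (hc.intervalIntegrable _ _)
    rw [h0, sub_zero] at this
    rw [← this]
    have h2 := intervalIntegral.norm_integral_le_of_norm_le_const (a := 0) (b := u) (f := g')
      (C := A * u) fun v hv => by
        rw [uIoc_of_le hu.le] at hv
        exact (hA v hv.1).trans (by gcongr; exact hv.2)
    rwa [sub_zero, abs_of_pos hu] at h2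
  have hrc : ∀ r : ℝ, ContinuousOn (fun u : ℝ => u ^ r) (Ioi 0) := fun r =>
    continuousOn_id.rpow_const fun u hu => Or.inl (ne_of_gt hu)
  have r1 : ∀ u : ℝ, u > 0 → u ^ (1 - α) = u * u ^ (-α) := fun u hu => by
    rw [sub_eq_add_neg, Real.rpow_add hu, Real.rpow_one]
  have r2 : ∀ u : ℝ, u > 0 → u ^ (-α) = u * u ^ (-α - 1) := fun u hu => by
    rw [← Real.rpow_one_add' hu.le (by linarith)]
    congr 1
    ring
  have I1 : IntegrableOn (fun z => g z * (c * z ^ (-α - 1))) (Ioi 0) := by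
    refine (integrableOn_Ioi_and_abs_integral_le (A := A) (D := D) (C := |c|) (f := fun _ => c)
      (F := fun z => g z * (c * z ^ (-α - 1))) hα1 hα2 (hgc.continuousOn.mul (continuousOn_const.mul (hrc _))) continuousOn_const
      (fun u _ => le_rfl) ?_ ?_).1
    · intro u hu
      have hp : 0 ≤ u ^ (-α - 1) := Real.rpow_nonneg hu.le _
      rw [r1 u hu, r2 u hu, abs_mul, abs_mul, abs_of_nonneg hp]
      calc |g u| * (|c| * u ^ (-α - 1)) ≤ A * u * u * (|c| * u ^ (-α - 1)) := by
            gcongr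
            exact hgA u hu
        _ = _ := by ring
    · intro u hu
      have hp : 0 ≤ u ^ (-α - 1) := Real.rpow_nonneg hu.le _
      rw [r2 u hu, abs_mul, abs_mul, abs_of_nonneg hp]
      calc |g u| * (|c| * u ^ (-α - 1)) ≤ D * u * (|c| * u ^ (-α - 1)) := by
            gcongr
            exact hgD u hu
        _ = _ := by ring
  have I2 : IntegrableOn (fun u => g' u * (c / α) * u ^ (-α)) (Ioi 0) := by
    refine (integrableOn_Ioi_and_abs_integral_le (A := A) (D := D) (C := |c / α|)
      (f := fun _ => c / α) (F := fun u => g' u * (c / α) * u ^ (-α)) hα1 hα2 ((hc.continuousOn.mul continuousOn_const).mul (hrc _))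
      continuousOn_const (fun u _ => le_rfl) ?_ ?_).1
    · intro u hu
      have hp : 0 ≤ u ^ (-α) := Real.rpow_nonneg hu.le _
      rw [r1 u hu, abs_mul, abs_mul, abs_of_nonneg hp]
      calc |g' u| * |c / α| * u ^ (-α) ≤ A * u * |c / α| * u ^ (-α) := by
            gcongr
            exact hA u hu
        _ = _ := by ring
    · intro u hu
      have hp : 0 ≤ u ^ (-α) := Real.rpow_nonneg hu.le _
      rw [abs_mul, abs_mul, abs_of_nonneg hp, ← mul_assoc]
      gcongr
      exact hD u hu
  refine ⟨I1, I2, ?_⟩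
  have hz : (0 : ℝ) ^ (-α) = 0 := Real.zero_rpow (by linarith)
  have key := integral_Ioi_of_hasDerivAt_of_tendsto (a := 0) (m := 0)
    (f := fun u => g u * (c / α) * u ^ (-α))
    (f' := fun u => g' u * (c / α) * u ^ (-α) - g u * (c * u ^ (-α - 1))) ?_ ?_
    (I2.sub I1) ?_
  · rw [integral_sub I2 I1] at key
    simp only [h0, zero_mul, sub_zero] at key
    linarith
  · rw [ContinuousWithinAt, h0, zero_mul, zero_mul]
    have hlim : Tendsto (fun u : ℝ => A * |c / α| * u ^ (2 - α)) (nhdsWithin 0 (Ici 0))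
        (nhds 0) := by
      have : ContinuousAt (fun u : ℝ => A * |c / α| * u ^ (2 - α)) 0 :=
        continuousAt_const.mul (continuousAt_id.rpow_const (Or.inr (by linarith)))
      have h := this.tendsto
      rw [Real.zero_rpow (by linarith : 2 - α ≠ 0), mul_zero] at h
      exact h.mono_left nhdsWithin_le_nhds
    refine squeeze_zero_norm' ?_ hlim
    filter_upwards [self_mem_nhdsWithin] with u hu
    rcases eq_or_lt_of_le (show (0 : ℝ) ≤ u from hu) with h | h
    · rw [← h, h0, zero_mul, zero_mul, norm_zero, Real.zero_rpow (by linarith : 2 - α ≠ 0),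
        mul_zero]
    · have hp : 0 ≤ u ^ (-α) := Real.rpow_nonneg h.le _
      have r3 : u ^ (2 - α) = u * u * u ^ (-α) := by
        rw [mul_assoc, ← r1 u h, ← Real.rpow_one_add' h.le (by linarith)]
        congr 1
        ring
      rw [Real.norm_eq_abs, abs_mul, abs_mul, abs_of_nonneg hp, r3]
      calc |g u| * |c / α| * u ^ (-α) ≤ A * u * u * |c / α| * u ^ (-α) := by
            gcongr
            exact hgA u h
        _ = _ := by ring
  · intro u hu
    have h1 := ((hd u).mul_const (c / α)).mul
      (Real.hasDerivAt_rpow_const (p := -α) (Or.inl (ne_of_gt (show (0 : ℝ) < u from hu))))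
    refine h1.congr_deriv ?_
    field_simp
    ring
  · have hlim : Tendsto (fun u : ℝ => D * |c / α| * u ^ (1 - α)) atTop (nhds 0) := by
      have := (tendsto_rpow_neg_atTop (y := α - 1) (by linarith)).const_mul (D * |c / α|)
      rwa [mul_zero, neg_sub] at this
    refine squeeze_zero_norm' ?_ hlim
    filter_upwards [eventually_gt_atTop 0] with u h
    have hp : 0 ≤ u ^ (-α) := Real.rpow_nonneg h.le _
    rw [Real.norm_eq_abs, abs_mul, abs_mul, abs_of_nonneg hp, r1 u h]
    calc |g u| * |c / α| * u ^ (-α) ≤ D * u * |c / α| * u ^ (-α) := by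
          gcongr
          exact hgD u h
      _ = _ := by ring

/-- One-sided error between the rescaled integral against a heavy-tailed law and the integral
against its limiting stable Lévy measure. -/
lemma abs_integral_tail_sub_stable_le {α c A D B : ℝ} (hα1 : 1 < α) (hα2 : α < 2) (hB : 0 < B)
    (μ : Measure ℝ) [IsFiniteMeasure μ] (hμ : Integrable (fun z : ℝ => z) μ)
    {b : ℝ → ℝ} (hb : ContinuousOn b (Ici 0)) (hlim : Tendsto b atTop (nhds 0))
    (htail : ∀ᵐ u ∂volume.restrict (Ioi 0), μ.real (Ioi u) = (c / α + b u) * u ^ (-α))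
    {g g' : ℝ → ℝ} (hd : ∀ z, HasDerivAt g (g' z) z) (hc : Continuous g') (h0 : g 0 = 0)
    (hA : ∀ u, |g' u| ≤ A * |u|) (hD : ∀ u, |g' u| ≤ D) :
    |B ^ (-α) * (∫ z in Ioi (0 : ℝ), g (B * z) ∂μ)
        - ∫ z in Ioi (0 : ℝ), g z * (c * z ^ (-α - 1))|
      ≤ A * (∫ u in Ioo (0 : ℝ) 1, |b (u / B)| * u ^ (1 - α))
        + D * ∫ u in Ioi (1 : ℝ), |b (u / B)| * u ^ (-α) := by
  have hA' : ∀ u > 0, |g' u| ≤ A * u := fun u hu => by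
    have := hA u
    rwa [abs_of_pos hu] at this
  obtain ⟨_, I2, hparts⟩ :=
    integral_mul_stable_density (c := c) hα1 hα2 hd hc h0 hA' fun u _ => hD u
  obtain ⟨C, hC⟩ := exists_abs_le_of_tendsto_atTop hb hlim
  have hbB : ContinuousOn (fun u => b (u / B)) (Ioi 0) :=
    hb.comp (continuous_id.div_const B).continuousOn fun u hu =>
      div_nonneg (le_of_lt (show (0 : ℝ) < u from hu)) hB.le
  have hrc : ContinuousOn (fun u : ℝ => u ^ (-α)) (Ioi 0) :=
    continuousOn_id.rpow_const fun u hu => Or.inl (ne_of_gt hu)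
  obtain ⟨I3, hbound⟩ := integrableOn_Ioi_and_abs_integral_le (A := A) (D := D) (C := C)
    (F := fun u => g' u * b (u / B) * u ^ (-α)) (f := fun u => b (u / B)) hα1 hα2
    ((hc.continuousOn.mul hbB).mul hrc) hbB (fun u hu => hC _ (div_nonneg (le_of_lt hu) hB.le))
    (fun u hu => by
      have hp : 0 ≤ u ^ (-α) := Real.rpow_nonneg hu.le _
      rw [sub_eq_add_neg, Real.rpow_add hu, Real.rpow_one, abs_mul, abs_mul, abs_of_nonneg hp]
      calc |g' u| * |b (u / B)| * u ^ (-α) ≤ A * u * |b (u / B)| * u ^ (-α) := by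
            gcongr
            exact hA' u hu
        _ = _ := by ring)
    (fun u hu => by
      have hp : 0 ≤ u ^ (-α) := Real.rpow_nonneg hu.le _
      rw [abs_mul, abs_mul, abs_of_nonneg hp, ← mul_assoc]
      gcongr
      exact hD u)
  have hmain : B ^ (-α) * (∫ z in Ioi (0 : ℝ), g (B * z) ∂μ)
      = ∫ u in Ioi (0 : ℝ), (g' u * (c / α) * u ^ (-α) + g' u * b (u / B) * u ^ (-α)) := by
    have hdB : ∀ z, HasDerivAt (fun z => g (B * z)) (g' (B * z) * B) z := fun z => by
      have h1 : HasDerivAt (fun z : ℝ => B * z) B z := by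
        simpa using (hasDerivAt_id z).const_mul B
      exact (hd (B * z)).comp z h1
    rw [setIntegral_Ioi_eq_integral_deriv_mul_tail μ hμ hdB (by fun_prop) (by simp [h0])
      (C := D * B) fun u => by
        rw [abs_mul, abs_of_pos hB]
        gcongr
        exact hD _]
    have hsub := integral_comp_mul_left_Ioi
      (fun u : ℝ => g' u * (c / α) * u ^ (-α) + g' u * b (u / B) * u ^ (-α)) 0 hB
    rw [mul_zero, smul_eq_mul, eq_inv_mul_iff_mul_eq₀ hB.ne'] at hsub
    rw [← hsub, ← integral_const_mul, ← integral_const_mul]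
    refine integral_congr_ae ?_
    filter_upwards [htail, ae_restrict_mem measurableSet_Ioi] with u hu hu0
    rw [hu, Real.mul_rpow hB.le (le_of_lt hu0), mul_div_cancel_left₀ _ hB.ne']
    ring
  rw [hmain, hparts, integral_add I2 I3, add_sub_cancel_left]
  exact hbound

lemma setIntegral_Iio_zero_eq_Ioi_neg (F : ℝ → ℝ) :
    ∫ z in Iio (0 : ℝ), F z = ∫ z in Ioi (0 : ℝ), F (-z) := by
  rw [integral_comp_neg_Ioi, neg_zero, integral_Iic_eq_integral_Iio]

/-- Error between the rescaled integral against a heavy-tailed law and the integral against its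
limiting two-sided stable Lévy measure. -/
lemma abs_integral_sub_levyNonlocal_le {α cm cp Δ A D : ℝ} (hα1 : 1 < α) (hα2 : α < 2)
    (hΔ : 0 < Δ) (P : Measure ℝ) [IsProbabilityMeasure P]
    (hP : Integrable (fun z : ℝ => z) P) {b1 b2 : ℝ → ℝ}
    (hb1 : ContinuousOn b1 (Iic 0)) (hb2 : ContinuousOn b2 (Ici 0))
    (hl1 : Tendsto b1 atBot (nhds 0)) (hl2 : Tendsto b2 atTop (nhds 0))
    (hneg : ∀ z < (0:ℝ), (P (Iic z)).toReal = (cm / α + b1 z) * |z| ^ (-α))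
    (hpos : ∀ z > (0:ℝ), (P (Iic z)).toReal = 1 - (cp / α + b2 z) * z ^ (-α))
    {w : ℝ → ℝ} {x : ℝ} (hw : Differentiable ℝ w) (hw' : Continuous (deriv w))
    (hA : ∀ u, |deriv w (x + u) - deriv w x| ≤ A * |u|)
    (hD : ∀ u, |deriv w (x + u) - deriv w x| ≤ 2 * D) :
    |(∫ z, (w (x + Δ ^ (1 / α) * z) - w x - deriv w x * (Δ ^ (1 / α) * z)) ∂P) / Δ
        - levyNonlocal α cm cp w x|
      ≤ 5 * R1expr α Δ b1 b2 * A + 4 * R2expr α Δ b1 b2 * D := by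
  set B := Δ ^ (1 / α) with hBdef
  have hα0 : α ≠ 0 := by linarith
  have hB : 0 < B := Real.rpow_pos_of_pos hΔ _
  have hBα : B ^ (-α) = Δ⁻¹ := by
    rw [hBdef, ← Real.rpow_mul hΔ.le, mul_neg, one_div_mul_cancel hα0, Real.rpow_neg_one]
  have hA0 : 0 ≤ A := by simpa using (abs_nonneg _).trans (hA 1)
  have hD0 : 0 ≤ D := by linarith [(abs_nonneg _).trans (hD 1)]
  set g : ℝ → ℝ := fun z => w (x + z) - w x - deriv w x * z with hg
  set g' : ℝ → ℝ := fun z => deriv w (x + z) - deriv w x with hg'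
  have hd : ∀ z, HasDerivAt g (g' z) z := fun z => by
    have h1 : HasDerivAt (fun z => w (x + z)) (deriv w (x + z)) z :=
      (hw (x + z)).hasDerivAt.comp_const_add x z
    have h2 : HasDerivAt (fun z => deriv w x * z) (deriv w x) z := by
      simpa using (hasDerivAt_id z).const_mul (deriv w x)
    exact (h1.sub_const (w x)).sub h2
  have hc : Continuous g' := by fun_prop
  have hg0 : g 0 = 0 := by simp [hg]
  have hgc : Continuous g := continuous_iff_continuousAt.2 fun z => (hd z).continuousAt
  have hgint : Integrable (fun z => g (B * z)) P := by
    refine Integrable.mono' ((hP.norm.const_mul (2 * D * B)))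
      (by fun_prop : Continuous fun z => g (B * z)).aestronglyMeasurable
      (Eventually.of_forall fun z => ?_)
    have := Convex.norm_image_sub_le_of_norm_hasDerivWithin_le (f := g) (f' := g') (s := univ)
      (x := 0) (y := B * z) (C := 2 * D) (fun z _ => (hd z).hasDerivWithinAt)
      (fun z _ => hD z) convex_univ (mem_univ _) (mem_univ _)
    rwa [hg0, sub_zero, sub_zero, norm_mul, Real.norm_of_nonneg hB.le, ← mul_assoc] at this
  have htail2 : ∀ᵐ u ∂volume.restrict (Ioi 0), P.real (Ioi u) = (cp / α + b2 u) * u ^ (-α) := by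
    filter_upwards [ae_restrict_mem measurableSet_Ioi] with u hu
    rw [← compl_Iic, probReal_compl_eq_one_sub measurableSet_Iic, Measure.real, hpos u hu]
    ring
  have e2 := abs_integral_tail_sub_stable_le (c := cp) hα1 hα2 hB P hP hb2 hl2 htail2 hd hc hg0
    hA hD
  have hmn : MeasurableEmbedding (fun z : ℝ => -z) := (Homeomorph.neg ℝ).measurableEmbedding
  have hQ : IsProbabilityMeasure (P.map fun z : ℝ => -z) :=
    Measure.isProbabilityMeasure_map measurable_neg.aemeasurable
  have htail1 : ∀ᵐ u ∂volume.restrict (Ioi 0),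
      (P.map fun z : ℝ => -z).real (Ioi u) = (cm / α + b1 (-u)) * u ^ (-α) := by
    filter_upwards [ae_restrict_mem measurableSet_Ioi,
      ae_restrict_of_ae (meas_le_ae_eq_meas_lt P volume fun z : ℝ => -z)] with u hu hu'
    have h1 : {a : ℝ | u ≤ -a} = Iic (-u) := by ext; simp [le_neg]
    have h2 := hneg (-u) (neg_lt_zero.2 hu)
    rw [abs_neg, abs_of_pos (show (0 : ℝ) < u from hu), ← h1, hu'] at h2
    rw [Measure.real, hmn.map_apply, ← h2]
    rfl
  have e1 := abs_integral_tail_sub_stable_le (c := cm) (A := A) (D := 2 * D) (g := fun z => g (-z))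
    (g' := fun z => -g' (-z)) (b := fun u => b1 (-u)) hα1 hα2 hB (P.map fun z : ℝ => -z)
    (hmn.integrable_map_iff.2 hP.neg)
    (hb1.comp continuous_neg.continuousOn fun u hu => by simpa using hu)
    (hl1.comp tendsto_neg_atTop_atBot) htail1
    (fun z => by
      have := (hd (-z)).comp z (hasDerivAt_neg z)
      rwa [mul_neg_one] at this)
    (by fun_prop) (by simpa using hg0) (fun u => by rw [abs_neg, ← abs_neg u]; exact hA (-u))
    (fun u => by rw [abs_neg]; exact hD (-u))
  rw [hmn.setIntegral_map] at e1
  have hpre : (fun z : ℝ => -z) ⁻¹' Ioi 0 = Iio 0 := by ext; simp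
  rw [hpre] at e1
  simp only [mul_neg, neg_neg] at e1
  have hsplit : ∫ z, g (B * z) ∂P
      = (∫ z in Iio (0 : ℝ), g (B * z) ∂P) + ∫ z in Ioi (0 : ℝ), g (B * z) ∂P := by
    rw [← integral_add_compl (measurableSet_Iio (a := (0 : ℝ))) hgint, compl_Iio,
      setIntegral_eq_of_subset_of_forall_sdiff_eq_zero (s := Ioi (0 : ℝ)) measurableSet_Ici
        Ioi_subset_Ici_self]
    intro z hz
    have : z = 0 := le_antisymm (not_lt.1 hz.2) hz.1
    simp [this, hg0]
  have hL : levyNonlocal α cm cp w x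
      = (∫ z in Ioi (0 : ℝ), g (-z) * (cm * z ^ (-α - 1)))
        + ∫ z in Ioi (0 : ℝ), g z * (cp * z ^ (-α - 1)) := by
    rw [levyNonlocal, setIntegral_Iio_zero_eq_Ioi_neg]
    congr 1
    refine setIntegral_congr_fun measurableSet_Ioi fun z hz => ?_
    simp only [abs_neg, abs_of_pos (show (0 : ℝ) < z from hz), hg]
  obtain ⟨C1, hC1⟩ := exists_abs_le_of_tendsto_atTop (b := fun u => b1 (-u))
    (hb1.comp continuous_neg.continuousOn fun u hu => by simpa using hu)
    (hl1.comp tendsto_neg_atTop_atBot)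
  obtain ⟨C2, hC2⟩ := exists_abs_le_of_tendsto_atTop hb2 hl2
  have hdiv : ∀ u > 0, 0 ≤ u / B := fun u hu => div_nonneg (le_of_lt hu) hB.le
  have c1 : ContinuousOn (fun u => |b1 (-(u / B))|) (Ioi 0) :=
    (hb1.comp (by fun_prop) fun u hu => by simpa using hdiv u hu).abs
  have c2 : ContinuousOn (fun u => |b2 (u / B)|) (Ioi 0) :=
    (hb2.comp (by fun_prop) fun u hu => by simpa using hdiv u hu).abs
  have d1 : ∀ u > 0, |(|b1 (-(u / B))|)| ≤ C1 := fun u hu => by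
    rw [abs_abs]
    exact hC1 _ (hdiv u hu)
  have d2 : ∀ u > 0, |(|b2 (u / B)|)| ≤ C2 := fun u hu => by
    rw [abs_abs]
    exact hC2 _ (hdiv u hu)
  have hR1 : R1expr α Δ b1 b2 = (∫ u in Ioo (0 : ℝ) 1, |b1 (-(u / B))| * u ^ (1 - α))
      + ∫ u in Ioo (0 : ℝ) 1, |b2 (u / B)| * u ^ (1 - α) := by
    rw [R1expr, ← integral_add
      ((integrableOn_Ioc_mul_rpow hα2 c1 d1).mono_set Ioo_subset_Ioc_self)
      ((integrableOn_Ioc_mul_rpow hα2 c2 d2).mono_set Ioo_subset_Ioc_self)]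
    simp only [← hBdef, add_mul]
  have hR2 : (∫ u in Ioi (1 : ℝ), |b1 (-(u / B))| * u ^ (-α))
      + (∫ u in Ioi (1 : ℝ), |b2 (u / B)| * u ^ (-α)) ≤ R2expr α Δ b1 b2 := by
    rw [R2expr, ← integral_add (integrableOn_Ioi_one_mul_rpow hα1 c1 d1)
      (integrableOn_Ioi_one_mul_rpow hα1 c2 d2)]
    simp only [← hBdef, ← add_mul]
    exact le_add_of_nonneg_left (by positivity)
  have hR10 : 0 ≤ R1expr α Δ b1 b2 :=
    setIntegral_nonneg measurableSet_Ioo fun u hu =>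
      mul_nonneg (by positivity) (Real.rpow_nonneg hu.1.le _)
  have hR20 : 0 ≤ R2expr α Δ b1 b2 := by
    refine le_trans (add_nonneg ?_ ?_) hR2 <;>
      exact setIntegral_nonneg measurableSet_Ioi fun u hu => mul_nonneg (abs_nonneg _)
        (Real.rpow_nonneg (zero_le_one.trans (le_of_lt hu)) _)
  rw [hsplit, hL, div_eq_inv_mul, ← hBα, mul_add, add_sub_add_comm]
  refine (abs_add_le _ _).trans ((add_le_add e1 e2).trans ?_)
  have p1 := mul_nonneg hR10 hA0
  have p2 := mul_nonneg hR20 hD0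
  have p3 := mul_le_mul_of_nonneg_right hR2 hD0
  have p4 := congrArg (· * A) hR1
  linarith

lemma R0expr_nonneg (α : ℝ) (b1 b2 : ℝ → ℝ) : 0 ≤ R0expr α b1 b2 :=
  add_nonneg (by positivity) (setIntegral_nonneg measurableSet_Ioo fun u hu =>
    mul_nonneg (by positivity) (Real.rpow_nonneg hu.1.le _))

/-- Suprema of two bounded families that are affinely related up to `ε` are so related. -/
lemma abs_sub_iSup_sub_div_le {K : Type*} [Nonempty K] {I L : K → ℝ} {Δ p q ε C : ℝ}
    (hΔ : 0 < Δ) (hI : ∀ k, |I k| ≤ C) (h : ∀ k, |q - L k - (p - I k) / Δ| ≤ ε) :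
    |q - (⨆ k, L k) - (p - ⨆ k, I k) / Δ| ≤ ε := by
  have hIb : BddAbove (range I) := ⟨C, by rintro _ ⟨k, rfl⟩; exact (abs_le.1 (hI k)).2⟩
  have hup : ∀ k, I k ≤ Δ * (ε - q + L k) + p := fun k => by
    have := (abs_le.1 (h k)).2
    have h2 : (p - I k) / Δ * Δ = p - I k := div_mul_cancel₀ _ hΔ.ne'
    nlinarith
  have hlo : ∀ k, L k ≤ q + ε - (p - I k) / Δ := fun k => by
    have := (abs_le.1 (h k)).1
    linarith
  have hLb : BddAbove (range L) := by
    refine ⟨q + ε - (p - C) / Δ, ?_⟩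
    rintro _ ⟨k, rfl⟩
    refine (hlo k).trans ?_
    have := (abs_le.1 (hI k)).2
    gcongr
  have s1 : (⨆ k, I k) ≤ Δ * (ε - q + ⨆ k, L k) + p := ciSup_le fun k => (hup k).trans (by
    gcongr
    exact le_ciSup hLb k)
  have s2 : (⨆ k, L k) ≤ q + ε - (p - ⨆ k, I k) / Δ := ciSup_le fun k => (hlo k).trans (by
    gcongr
    exact le_ciSup hIb k)
  have h2 : (p - ⨆ k, I k) / Δ ≥ q - ε - ⨆ k, L k := by
    rw [ge_iff_le, le_div_iff₀ hΔ]
    linarith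
  exact abs_le.2 ⟨by linarith, by linarith⟩

lemma abs_sub_le_of_abs_deriv_le {f : ℝ → ℝ} (hf : Differentiable ℝ f) {C : ℝ}
    (hC : ∀ u, |deriv f u| ≤ C) (a b : ℝ) : |f b - f a| ≤ C * |b - a| :=
  Convex.norm_image_sub_le_of_norm_deriv_le (fun u _ => hf u) (fun u _ => hC u) convex_univ
    (mem_univ a) (mem_univ b)

/-- First-order Taylor bound from a Lipschitz bound on the derivative, backwards in time. -/
lemma abs_sub_add_deriv_mul_le {f : ℝ → ℝ} (hf : Differentiable ℝ f)
    (hf' : Differentiable ℝ (deriv f)) {C : ℝ} (hC : ∀ u, |deriv (deriv f) u| ≤ C) {t Δ : ℝ}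
    (hΔ : 0 < Δ) : |f (t - Δ) - f t + Δ * deriv f t| ≤ C * Δ * Δ := by
  have hC0 : 0 ≤ C := (abs_nonneg _).trans (hC 0)
  obtain ⟨c, hc, he⟩ := exists_deriv_eq_slope f (sub_lt_self t hΔ) hf.continuous.continuousOn
    hf.differentiableOn
  rw [sub_sub_cancel, eq_div_iff hΔ.ne'] at he
  have : f (t - Δ) - f t + Δ * deriv f t = Δ * (deriv f t - deriv f c) := by linarith
  rw [this, abs_mul, abs_of_pos hΔ, mul_comm]
  gcongr
  refine (abs_sub_le_of_abs_deriv_le hf' hC c t).trans ?_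
  gcongr
  rw [abs_of_pos (sub_pos.2 hc.2)]
  linarith [hc.1]

/-- consistency of the scheme (Proposition 5.1 (iii)). -/
theorem scheme_consistency
    {α lam1 lam2 : ℝ} (hα1 : 1 < α) (hα2 : α < 2)
    (hlam1 : 0 ≤ lam1) (hlam : lam1 < lam2)
    {K : Type*} [Nonempty K]
    (km kp : K → ℝ)
    (hkm : ∀ k, km k ∈ Set.Ioo lam1 lam2)
    (hkp : ∀ k, kp k ∈ Set.Ioo lam1 lam2)
    (P : K → Measure ℝ)
    (hP : ∀ k, IsProbabilityMeasure (P k))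
    (hint : ∀ k, Integrable (fun z : ℝ => z) (P k))
    (hmean : ∀ k, ∫ z, z ∂(P k) = 0)
    (β1 β2 : K → ℝ → ℝ)
    (hβ1meas : ∀ k, Measurable (β1 k))
    (hβ2meas : ∀ k, Measurable (β2 k))
    (hcdfneg : ∀ k, ∀ z < (0:ℝ), ((P k) (Set.Iic z)).toReal = (km k / α + β1 k z) * |z| ^ (-α))
    (hcdfpos : ∀ k, ∀ z > (0:ℝ), ((P k) (Set.Iic z)).toReal = 1 - (kp k / α + β2 k z) * z ^ (-α))
    (hβ1lim : ∀ k, Tendsto (β1 k) atBot (nhds 0))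
    (hβ2lim : ∀ k, Tendsto (β2 k) atTop (nhds 0))
    (hA1a : ∀ k, ContDiffOn ℝ 1 (β1 k) (Set.Iic 0))
    (hA1b : ∀ k, ContDiffOn ℝ 1 (β2 k) (Set.Ici 0))
    (hMξb : BddAbove (Set.range fun k => ∫ z, |z| ∂(P k)))
    (T Δ : ℝ) (hT : 0 < T) (hΔ : Δ ∈ Set.Ioo (0 : ℝ) 1)
    (hR0b : BddAbove (Set.range fun k => R0expr α (β1 k) (β2 k)))
    (hR1b : BddAbove (Set.range fun k => R1expr α Δ (β1 k) (β2 k)))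
    (hR2b : BddAbove (Set.range fun k => R2expr α Δ (β1 k) (β2 k)))
    (ω : ℝ → ℝ → ℝ)
    (hω : ContDiff ℝ (⊤ : ℕ∞) (fun q : ℝ × ℝ => ω q.1 q.2))
    (hωbd : ∀ n : ℕ, ∃ Cn, ∀ q : ℝ × ℝ,
      ‖iteratedFDeriv ℝ n (fun q : ℝ × ℝ => ω q.1 q.2) q‖ ≤ Cn)
    (Att Atx Ax Axx : ℝ)
    (hAtt : ∀ t x : ℝ, |deriv (fun s => deriv (fun r => ω r x) s) t| ≤ Att)
    (hAtx : ∀ t x : ℝ, |deriv (fun y => deriv (fun s => ω s y) t) x| ≤ Atx)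
    (hAx : ∀ t x : ℝ, |deriv (fun y => ω t y) x| ≤ Ax)
    (hAxx : ∀ t x : ℝ, |deriv (fun y => deriv (ω t) y) x| ≤ Axx)
    (t x : ℝ) (ht : t ∈ Set.Icc Δ T) :
    |deriv (fun s => ω s x) t
        - (⨆ k, levyNonlocal α (km k) (kp k) (ω t) x)
        - schemeS P α Δ x (ω t x) (ω (t - Δ))|
      ≤ (1 + (⨆ k, ∫ z, |z| ∂(P k))) * (Att * Δ + Atx * Δ ^ (1 / α))
        + (⨆ k, R0expr α (β1 k) (β2 k)) * Axx * Δ ^ ((2 - α) / α)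
        + (5 * (⨆ k, R1expr α Δ (β1 k) (β2 k))) * Axx
        + (4 * (⨆ k, R2expr α Δ (β1 k) (β2 k))) * Ax := by
  obtain ⟨hΔ0, -⟩ := hΔ
  set B := Δ ^ (1 / α) with hBdef
  have hB : 0 < B := Real.rpow_pos_of_pos hΔ0 _
  have hAtt0 : 0 ≤ Att := (abs_nonneg _).trans (hAtt 0 0)
  have hAtx0 : 0 ≤ Atx := (abs_nonneg _).trans (hAtx 0 0)
  have hAx0 : 0 ≤ Ax := (abs_nonneg _).trans (hAx 0 0)
  have hAxx0 : 0 ≤ Axx := (abs_nonneg _).trans (hAxx 0 0)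
  have htime : ∀ y, ContDiff ℝ (⊤ : ℕ∞) fun s => ω s y := fun y =>
    hω.comp (contDiff_id.prodMk contDiff_const)
  have hspace : ∀ s, ContDiff ℝ (⊤ : ℕ∞) (ω s) := fun s =>
    hω.comp (contDiff_const.prodMk contDiff_id)
  have hdiff : ∀ {f : ℝ → ℝ}, ContDiff ℝ (⊤ : ℕ∞) f →
      Differentiable ℝ f ∧ Differentiable ℝ (deriv f) := fun hf =>
    ⟨hf.differentiable (by simp), (contDiff_infty_iff_deriv.1 hf).2.differentiable (by simp)⟩
  have hmixed : Differentiable ℝ fun y => deriv (fun s => ω s y) t := by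
    have e : (fun y => deriv (fun s => ω s y) t)
        = fun y => fderiv ℝ (fun q : ℝ × ℝ => ω q.1 q.2) (t, y) (1, 0) := by
      ext y
      have h1 : HasDerivAt (fun s : ℝ => (s, y)) ((1 : ℝ), (0 : ℝ)) t :=
        (hasDerivAt_id t).prodMk (hasDerivAt_const t y)
      exact ((hω.differentiable (by simp) (t, y)).hasFDerivAt.comp_hasDerivAt t h1).deriv
    rw [e]
    have h2 := (contDiff_infty_iff_fderiv.1 hω).2
    have h3 : Differentiable ℝ fun y : ℝ => (t, y) := by fun_prop
    exact ((h2.differentiable (by simp)).comp h3).clm_apply (differentiable_const _)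
  obtain ⟨C, hC⟩ := hωbd 0
  have hωC : ∀ s y, |ω s y| ≤ C := fun s y => by
    have := hC (s, y)
    rwa [norm_iteratedFDeriv_zero] at this
  have hωint : ∀ k s, Integrable (fun z => ω s (x + B * z)) (P k) := fun k s => by
    have := hP k
    have hc : Continuous fun z => ω s (x + B * z) := (hspace s).continuous.comp (by fun_prop)
    exact Integrable.of_bound hc.aestronglyMeasurable C (Eventually.of_forall fun z => hωC _ _)
  refine abs_sub_iSup_sub_div_le hΔ0 (C := C) (fun k => ?_) fun k => ?_
  · have := hP k
    have := norm_integral_le_of_norm_le_const (μ := P k) (C := C)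
      (f := fun z => ω (t - Δ) (x + B * z)) (Eventually.of_forall fun z => hωC _ _)
    rwa [probReal_univ, mul_one] at this
  have := hP k
  set M := ⨆ k, ∫ z, |z| ∂(P k) with hM
  set I := ∫ z, ω (t - Δ) (x + B * z) ∂(P k) with hI
  set J := ∫ z, ω t (x + B * z) ∂(P k) with hJ
  set q := deriv (fun s => ω s x) t with hq
  have hMk : ∫ z, |z| ∂(P k) ≤ M := le_ciSup hMξb k
  have hR1k := le_ciSup hR1b k
  have hR2k := le_ciSup hR2b k
  have hR0 : 0 ≤ ⨆ k, R0expr α (β1 k) (β2 k) := Real.iSup_nonneg fun k => R0expr_nonneg _ _ _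
  have hωdiff : Integrable (fun z => ω (t - Δ) (x + B * z) - ω t (x + B * z)) (P k) :=
    (hωint k _).sub (hωint k _)
  have hωincr : Integrable (fun z => ω t (x + B * z) - ω t x) (P k) :=
    (hωint k _).sub (integrable_const _)
  have hr : ∫ z, (ω (t - Δ) (x + B * z) - ω t (x + B * z) + Δ * q) ∂(P k) = I - J + Δ * q := by
    rw [integral_add hωdiff (integrable_const _),
      integral_sub (hωint k _) (hωint k _)]
    simp [hI, hJ]
  have hδ : ∫ z, (ω t (x + B * z) - ω t x - deriv (ω t) x * (B * z)) ∂(P k) = J - ω t x := by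
    rw [integral_sub hωincr (((hint k).const_mul B).const_mul (deriv (ω t) x)),
      integral_sub (hωint k _) (integrable_const _), integral_const_mul, integral_const_mul,
      hmean k]
    simp [hJ]
  have htimeErr : |I - J + Δ * q| ≤ (Att * Δ + Atx * B * M) * Δ := by
    rw [← hr]
    have hptwise : ∀ z, ‖ω (t - Δ) (x + B * z) - ω t (x + B * z) + Δ * q‖
        ≤ Att * Δ * Δ + Atx * B * Δ * |z| := fun z => by
      have h1 := abs_sub_add_deriv_mul_le (hdiff (htime (x + B * z))).1
        (hdiff (htime (x + B * z))).2 (fun s => hAtt s (x + B * z)) (t := t) hΔ0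
      have h2 := abs_sub_le_of_abs_deriv_le hmixed (hAtx t) (x + B * z) x
      rw [sub_add_cancel_left, abs_neg, abs_mul, abs_of_pos hB] at h2
      have h3 : ω (t - Δ) (x + B * z) - ω t (x + B * z) + Δ * q
          = (ω (t - Δ) (x + B * z) - ω t (x + B * z)
              + Δ * deriv (fun s => ω s (x + B * z)) t)
            + Δ * (q - deriv (fun s => ω s (x + B * z)) t) := by ring
      rw [h3]
      refine (norm_add_le _ _).trans (add_le_add h1 ?_)
      rw [norm_mul, Real.norm_of_nonneg hΔ0.le]
      exact (mul_le_mul_of_nonneg_left h2 hΔ0.le).trans_eq (by ring)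
    have habs : Integrable (fun z : ℝ => |z|) (P k) := (hint k).abs
    refine (norm_integral_le_of_norm_le ((integrable_const _).fun_add (habs.const_mul _))
      (Eventually.of_forall hptwise)).trans ?_
    rw [integral_add (integrable_const _) (habs.const_mul _), integral_const,
      integral_const_mul, probReal_univ, one_smul]
    have : Atx * B * Δ * ∫ z, |z| ∂(P k) ≤ Atx * B * Δ * M := by gcongr
    linarith
  have hdw := fun u => abs_sub_le_of_abs_deriv_le (hdiff (hspace t)).2 (hAxx t) x (x + u)
  simp only [add_sub_cancel_left] at hdw
  have hlevy := abs_integral_sub_levyNonlocal_le (cm := km k) (cp := kp k) (D := Ax) (x := x)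
    hα1 hα2 hΔ0 (P k) (hint k) (hA1a k).continuousOn (hA1b k).continuousOn (hβ1lim k) (hβ2lim k)
    (hcdfneg k) (hcdfpos k) (hdiff (hspace t)).1 (hdiff (hspace t)).2.continuous hdw fun u => by
      have h1 := abs_le.1 (hAx t (x + u))
      have h2 := abs_le.1 (hAx t x)
      exact abs_le.2 ⟨by linarith, by linarith⟩
  rw [← hBdef, hδ] at hlevy
  have hdecomp : q - levyNonlocal α (km k) (kp k) (ω t) x - (ω t x - I) / Δ
      = (I - J + Δ * q) / Δ + ((J - ω t x) / Δ - levyNonlocal α (km k) (kp k) (ω t) x) := by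
    field_simp
    ring
  rw [hdecomp]
  refine (abs_add_le _ _).trans ?_
  have htimeErr' : |(I - J + Δ * q) / Δ| ≤ Att * Δ + Atx * B * M := by
    rwa [abs_div, abs_of_pos hΔ0, div_le_iff₀ hΔ0]
  have hM0 : 0 ≤ M := (integral_nonneg fun z => abs_nonneg z).trans hMk
  have n1 : 0 ≤ M * (Att * Δ) := by positivity
  have n2 : 0 ≤ Atx * B := by positivity
  have n3 : 0 ≤ (⨆ k, R0expr α (β1 k) (β2 k)) * Axx * Δ ^ ((2 - α) / α) :=
    mul_nonneg (mul_nonneg hR0 hAxx0) (Real.rpow_nonneg hΔ0.le _)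
  have n4 := mul_le_mul_of_nonneg_right hR1k hAxx0
  have n5 := mul_le_mul_of_nonneg_right hR2k hAx0
  linarith
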